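/- arXiv:2401.06871 — 3 statements merged into one kernel-verified Lean document; each statement's English description precedes it below -/
import Mathlib

section
/- Let φ : ℝ → ℂ be any continuous function. Then there exists a function u, continuous on the closed upper half-plane {τ ∈ ℂ : Im τ ≥ 0} and harmonic on ℍ, such that u(t) = φ(t) for every t ∈ ℝ. -/
noncomputable section

/-- A function `h : ℂ → ℂ` is harmonic on the upper half-plane `ℍ` if, writing
`τ = x + iy`, it is twice continuously differentiable as a function of `(x, y)` there
and satisfies `∂²h/∂x² + ∂²h/∂y² = 0` on `ℍ`. -/
def HarmonicOnH (h : ℂ → ℂ) : Prop :=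
  ContDiffOn ℝ 2 (fun p : ℝ × ℝ => h ((p.1 : ℂ) + (p.2 : ℂ) * Complex.I))
      {p : ℝ × ℝ | 0 < p.2} ∧
  ∀ τ : ℂ, 0 < τ.im →
    deriv (fun x : ℝ => deriv (fun x' : ℝ => h ((x' : ℂ) + (τ.im : ℂ) * Complex.I)) x) τ.re +
      deriv (fun y : ℝ => deriv (fun y' : ℝ => h ((τ.re : ℂ) + (y' : ℂ) * Complex.I)) y) τ.im = 0

open Filter Topology MeasureTheory ComplexConjugate

/-- An entire function whose modulus on the real line dominates a given continuous function. -/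
theorem exists_entire_ge (w : ℝ → ℝ) (hw : Continuous w) :
    ∃ G : ℂ → ℂ, Differentiable ℂ G ∧ ∀ t : ℝ, w t ≤ ‖G t‖ := by
  have hB : ∀ R : ℝ, ∃ B : ℝ, 0 ≤ B ∧ ∀ t : ℝ, |t| ≤ R → w t ≤ B := by
    intro R
    obtain ⟨B, hB⟩ := (isCompact_Icc (a := -R) (b := R)).bddAbove_image hw.continuousOn
    exact ⟨max B 0, le_max_right _ _, fun t ht =>
      (hB ⟨t, abs_le.mp ht, rfl⟩).trans (le_max_left _ _)⟩
  choose B hB0 hB using hB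
  have hk : ∀ n : ℕ, ∃ k : ℕ, n ≤ k ∧
      B (n + 3) ≤ (((n : ℝ) + 2) ^ 2 / ((n : ℝ) + 1) ^ 2) ^ k := by
    intro n
    have h1 : 1 < ((n : ℝ) + 2) ^ 2 / ((n : ℝ) + 1) ^ 2 := by
      rw [one_lt_div (by positivity)]
      nlinarith [(Nat.cast_nonneg n : (0 : ℝ) ≤ n)]
    exact ((eventually_ge_atTop n).and
      ((tendsto_pow_atTop_atTop_of_one_lt h1).eventually_ge_atTop _)).exists
  choose k hkn hkB using hk
  have hsum : ∀ R : ℝ, Summable fun n : ℕ => (R ^ 2 / ((n : ℝ) + 1) ^ 2) ^ k n := by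
    intro R
    refine Summable.of_norm_bounded_eventually_nat
      (summable_geometric_of_lt_one (r := 1 / 4) (by norm_num) (by norm_num)) ?_
    filter_upwards [eventually_ge_atTop ⌈2 * |R|⌉₊] with n hn
    have hn' : 2 * |R| ≤ n := (Nat.le_ceil _).trans (by exact_mod_cast hn)
    rw [Real.norm_of_nonneg (by positivity)]
    have h2 : R ^ 2 / ((n : ℝ) + 1) ^ 2 ≤ 1 / 4 := by
      rw [div_le_iff₀ (by positivity), ← sq_abs R]
      nlinarith [abs_nonneg R]
    calc _ ≤ (1 / 4 : ℝ) ^ k n := by gcongr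
      _ ≤ _ := pow_le_pow_of_le_one (by norm_num) (by norm_num) (hkn n)
  refine ⟨fun z => (B 2 : ℂ) + ∑' n : ℕ, (z ^ 2 / ((n : ℂ) + 1) ^ 2) ^ k n, ?_, ?_⟩
  · refine (differentiable_const _).add fun z => ?_
    have := Complex.differentiableOn_tsum_of_summable_norm (hsum (‖z‖ + 1))
      (F := fun (n : ℕ) (z : ℂ) => (z ^ 2 / ((n : ℂ) + 1) ^ 2) ^ k n)
      (U := Metric.ball 0 (‖z‖ + 1)) (fun n => by fun_prop) Metric.isOpen_ball ?_
    · exact this.differentiableAt (Metric.isOpen_ball.mem_nhds (by simp))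
    · intro n v hv
      rw [mem_ball_zero_iff] at hv
      have h3 : ‖((n : ℂ) + 1)‖ = (n : ℝ) + 1 := by exact_mod_cast Complex.norm_natCast (n + 1)
      rw [norm_pow, norm_div, norm_pow, norm_pow, h3]
      gcongr
  · intro t
    have h4 : ((B 2 : ℂ) + ∑' n : ℕ, ((t : ℂ) ^ 2 / ((n : ℂ) + 1) ^ 2) ^ k n)
        = ((B 2 + ∑' n : ℕ, (t ^ 2 / ((n : ℝ) + 1) ^ 2) ^ k n : ℝ) : ℂ) := by
      push_cast
      rfl
    have hnn : ∀ n : ℕ, 0 ≤ (t ^ 2 / ((n : ℝ) + 1) ^ 2) ^ k n := fun n => by positivity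
    beta_reduce
    rw [h4, Complex.norm_real, Real.norm_of_nonneg (add_nonneg (hB0 2) (tsum_nonneg hnn))]
    rcases le_or_gt |t| 2 with h | h
    · exact (hB 2 t h).trans (le_add_of_nonneg_right (tsum_nonneg hnn))
    · obtain ⟨n, hn⟩ : ∃ n : ℕ, ⌊|t|⌋₊ = n + 2 :=
        Nat.exists_eq_add_of_le' (Nat.le_floor (by exact_mod_cast h.le))
      have h5 := Nat.floor_le (abs_nonneg t)
      have h6 := Nat.lt_floor_add_one |t|
      rw [hn] at h5 h6
      push_cast at h5 h6
      calc w t ≤ B (n + 3) := hB _ t (by linarith)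
        _ ≤ _ := hkB n
        _ ≤ (t ^ 2 / ((n : ℝ) + 1) ^ 2) ^ k n := by
          rw [← sq_abs t]
          gcongr
        _ ≤ _ := (hsum t).le_tsum n fun j _ => hnn j
        _ ≤ _ := by linarith [hB0 2]

/-- The Cauchy transform of `ψ`. -/
def cauchyTransform (ψ : ℝ → ℂ) (z : ℂ) : ℂ := ∫ t : ℝ, ψ t / (t - z)

theorem abs_im_le_norm_ofReal_sub (t : ℝ) (z : ℂ) : |z.im| ≤ ‖(t : ℂ) - z‖ := by
  simpa using Complex.abs_im_le_norm ((t : ℂ) - z)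

theorem ofReal_sub_ne_zero {z : ℂ} (hz : z.im ≠ 0) (t : ℝ) : (t : ℂ) - z ≠ 0 := by
  intro h
  have := congrArg Complex.im h
  simp at this
  exact hz this

theorem integrable_div_ofReal_sub {ψ : ℝ → ℂ} (hψ : Continuous ψ) (hi : Integrable ψ) {z : ℂ}
    (hz : z.im ≠ 0) : Integrable fun t : ℝ => ψ t / (t - z) := by
  have hc : Continuous fun t : ℝ => ψ t / (t - z) :=
    hψ.div (by fun_prop) (ofReal_sub_ne_zero hz)
  refine (hi.norm.div_const |z.im|).mono' hc.aestronglyMeasurable (.of_forall fun t => ?_)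
  rw [norm_div]
  have := abs_pos.mpr hz
  gcongr
  exact abs_im_le_norm_ofReal_sub t z

theorem differentiableAt_cauchyTransform {ψ : ℝ → ℂ} (hψ : Continuous ψ) (hi : Integrable ψ)
    {z : ℂ} (hz : z.im ≠ 0) : DifferentiableAt ℂ (cauchyTransform ψ) z := by
  have hpos := abs_pos.mpr hz
  have him : ∀ v ∈ Metric.ball z (|z.im| / 2), |z.im| / 2 ≤ |v.im| := by
    intro v hv
    rw [mem_ball_iff_norm] at hv
    have h1 := (Complex.abs_im_le_norm (v - z)).trans_lt hv
    rw [Complex.sub_im, abs_sub_comm] at h1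
    linarith [abs_sub_abs_le_abs_sub z.im v.im]
  have hne : ∀ v ∈ Metric.ball z (|z.im| / 2), v.im ≠ 0 := fun v hv =>
    abs_pos.mp ((half_pos hpos).trans_le (him v hv))
  refine (hasDerivAt_integral_of_dominated_loc_of_deriv_le
    (F := fun (v : ℂ) (t : ℝ) => ψ t / (t - v)) (F' := fun (v : ℂ) (t : ℝ) => ψ t / (t - v) ^ 2)
    (bound := fun t => ‖ψ t‖ / (|z.im| / 2) ^ 2)
    (Metric.ball_mem_nhds z (half_pos hpos)) ?_ (integrable_div_ofReal_sub hψ hi hz) ?_ ?_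
    (hi.norm.div_const _) ?_).2.differentiableAt
  · filter_upwards [Metric.ball_mem_nhds z (half_pos hpos)] with v hv
    exact (integrable_div_ofReal_sub hψ hi (hne v hv)).aestronglyMeasurable
  · exact (hψ.div (by fun_prop)
      fun t => pow_ne_zero 2 (ofReal_sub_ne_zero hz t)).aestronglyMeasurable
  · refine .of_forall fun t v hv => ?_
    rw [norm_div, norm_pow]
    gcongr
    exact (him v hv).trans (abs_im_le_norm_ofReal_sub t v)
  · refine .of_forall fun t v hv => ?_
    have h0 := ofReal_sub_ne_zero (hne v hv) t
    have := (hasDerivAt_const v (ψ t)).div ((hasDerivAt_id v).const_sub (t : ℂ)) h0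
    exact this.congr_deriv (by simp)

/-- The Poisson integral of `ψ`, rescaled so that it makes sense on all of `ℂ`. -/
def poissonIntegral (ψ : ℝ → ℂ) (z : ℂ) : ℂ :=
  (Real.pi : ℂ)⁻¹ * ∫ s : ℝ, (((1 + s ^ 2)⁻¹ : ℝ) : ℂ) * ψ (z.re + z.im * s)

theorem continuous_poissonIntegral {ψ : ℝ → ℂ} (hψ : Continuous ψ) {M : ℝ}
    (hM : ∀ t, ‖ψ t‖ ≤ M) : Continuous (poissonIntegral ψ) := by
  have hk : Continuous fun s : ℝ => (1 + s ^ 2)⁻¹ :=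
    Continuous.inv₀ (by fun_prop) fun s => by positivity
  refine continuous_const.mul (continuous_of_dominated
    (bound := fun s : ℝ => (1 + s ^ 2)⁻¹ * M) (fun z => ?_) (fun z => .of_forall fun s => ?_)
    (integrable_inv_one_add_sq.mul_const M) (.of_forall fun s => by fun_prop))
  · exact Continuous.aestronglyMeasurable (by fun_prop)
  · rw [norm_mul, Complex.norm_real, Real.norm_of_nonneg (by positivity)]
    gcongr
    exact hM _

theorem poissonIntegral_ofReal (ψ : ℝ → ℂ) (t : ℝ) : poissonIntegral ψ t = ψ t := by
  have hpi : (Real.pi : ℂ) ≠ 0 := by exact_mod_cast Real.pi_ne_zero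
  simp only [poissonIntegral, Complex.ofReal_re, Complex.ofReal_im, zero_mul, add_zero]
  rw [integral_mul_const, integral_complex_ofReal, integral_univ_inv_one_add_sq]
  field_simp

theorem poissonIntegral_eq_cauchyTransform {ψ : ℝ → ℂ} (hψ : Continuous ψ) (hi : Integrable ψ)
    {z : ℂ} (hz : 0 < z.im) :
    poissonIntegral ψ z = (2 * Real.pi * Complex.I)⁻¹ *
      (cauchyTransform ψ z - cauchyTransform ψ (conj z)) := by
  have hz' : (conj z).im ≠ 0 := by simpa using hz.ne'
  have key : cauchyTransform ψ z - cauchyTransform ψ (conj z) =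
      2 * Complex.I * ∫ s : ℝ, (((1 + s ^ 2)⁻¹ : ℝ) : ℂ) * ψ (z.re + z.im * s) := by
    unfold cauchyTransform
    rw [← integral_sub (integrable_div_ofReal_sub hψ hi hz.ne')
      (integrable_div_ofReal_sub hψ hi hz')]
    rw [← integral_add_left_eq_self _ z.re]
    have hscale := Measure.integral_comp_mul_left
      (fun t : ℝ => ψ (z.re + t) / (((z.re + t : ℝ) : ℂ) - z)
        - ψ (z.re + t) / (((z.re + t : ℝ) : ℂ) - conj z)) z.im
    rw [abs_of_pos (inv_pos.mpr hz), eq_inv_smul_iff₀ hz.ne'] at hscale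
    rw [← hscale, ← integral_smul, ← integral_const_mul]
    congr 1
    ext s
    have h1 : (((z.re + z.im * s : ℝ) : ℂ) - z) = z.im * (s - Complex.I) := by
      apply Complex.ext <;> simp
    have h2 : (((z.re + z.im * s : ℝ) : ℂ) - conj z) = z.im * (s + Complex.I) := by
      apply Complex.ext <;> simp
    have h3 : (s : ℂ) - Complex.I ≠ 0 := ofReal_sub_ne_zero (by simp) s
    have h4 : (s : ℂ) + Complex.I ≠ 0 := by
      simpa using ofReal_sub_ne_zero (z := -Complex.I) (by simp) s
    have h5 : (z.im : ℂ) ≠ 0 := by exact_mod_cast hz.ne'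
    have h6 : (1 + (s : ℂ) ^ 2) = (s - Complex.I) * (s + Complex.I) := by
      linear_combination Complex.I_sq
    rw [h1, h2, Complex.real_smul]
    push_cast
    rw [h6]
    field_simp
    ring
  have hpi : (Real.pi : ℂ) ≠ 0 := by exact_mod_cast Real.pi_ne_zero
  have h7 : (2 * Real.pi * Complex.I)⁻¹ * (2 * Complex.I) = (Real.pi : ℂ)⁻¹ := by field_simp
  rw [key, poissonIntegral, ← mul_assoc, h7]

theorem tendsto_im_mul_cauchyTransform_conj {ψ : ℝ → ℂ} (hψ : Continuous ψ) (hi : Integrable ψ)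
    (x : ℝ) : Tendsto (fun z : ℂ => (z.im : ℂ) * cauchyTransform ψ (conj z)) (𝓝 (x : ℂ)) (𝓝 0) := by
  have h : Tendsto (fun z : ℂ => ∫ t : ℝ, (z.im : ℂ) * (ψ t / (t - conj z))) (𝓝 (x : ℂ))
      (𝓝 (∫ _ : ℝ, (0 : ℂ))) := by
    refine tendsto_integral_filter_of_dominated_convergence (fun t => ‖ψ t‖) ?_ ?_ hi.norm ?_
    · refine .of_forall fun z => ?_
      rcases eq_or_ne z.im 0 with h0 | h0
      · simpa [h0] using aestronglyMeasurable_const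
      · exact ((integrable_div_ofReal_sub hψ hi
          (by simpa using h0 : (conj z).im ≠ 0)).const_mul _).aestronglyMeasurable
    · refine .of_forall fun z => .of_forall fun t => ?_
      have h1 : |z.im| ≤ ‖(t : ℂ) - conj z‖ := by
        simpa using abs_im_le_norm_ofReal_sub t (conj z)
      rw [norm_mul, norm_div, Complex.norm_real, Real.norm_eq_abs, mul_div_left_comm]
      exact mul_le_of_le_one_right (norm_nonneg _) (div_le_one_of_le₀ h1 (norm_nonneg _))
    · have hae : ∀ᵐ t : ℝ, t ≠ x := by simp [ae_iff]
      filter_upwards [hae] with t ht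
      have h2 : (t : ℂ) - conj (x : ℂ) ≠ 0 := by
        rw [Complex.conj_ofReal, sub_ne_zero]
        exact_mod_cast ht
      have : ContinuousAt (fun z : ℂ => (z.im : ℂ) * (ψ t / (t - conj z))) (x : ℂ) :=
        ContinuousAt.mul (by fun_prop) (ContinuousAt.div (by fun_prop)
          (continuous_const.sub Complex.continuous_conj).continuousAt h2)
      simpa [ContinuousAt] using this
  simpa [cauchyTransform, integral_const_mul] using h

theorem continuous_sub_conj_mul_cauchyTransform {G : ℂ → ℂ} (hG : Differentiable ℂ G)
    {ψ : ℝ → ℂ} (hψ : Continuous ψ) (hi : Integrable ψ) :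
    Continuous fun z : ℂ => (G z - G (conj z)) * cauchyTransform ψ (conj z) := by
  refine continuous_iff_continuousAt.mpr fun z => ?_
  rcases eq_or_ne z.im 0 with h0 | h0
  · obtain ⟨x, rfl⟩ : ∃ x : ℝ, (x : ℂ) = z := ⟨z.re, Complex.ext rfl (by simp [h0])⟩
    obtain ⟨K, s, hs, hK⟩ := (hG.contDiff (n := 1)).contDiffAt (x := (x : ℂ))
      |>.exists_lipschitzOnWith
    have hs' : ∀ᶠ v in 𝓝 (x : ℂ), conj v ∈ s :=
      Complex.continuous_conj.continuousAt.eventually (by rwa [Complex.conj_ofReal])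
    have h1 := (tendsto_im_mul_cauchyTransform_conj hψ hi x).norm.const_mul (2 * (K : ℝ))
    rw [norm_zero, mul_zero] at h1
    simp only [ContinuousAt, Complex.conj_ofReal, sub_self, zero_mul]
    refine squeeze_zero_norm' ?_ h1
    filter_upwards [hs, hs'] with v hv hv'
    have h2 := hK.norm_sub_le hv hv'
    have h3 : ‖v - conj v‖ = 2 * ‖(v.im : ℂ)‖ := by
      rw [Complex.sub_conj]
      simp
    rw [norm_mul, norm_mul]
    calc _ ≤ (K * ‖v - conj v‖) * ‖cauchyTransform ψ (conj v)‖ := by gcongr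
      _ = _ := by rw [h3]; ring
  · have h1 : ContinuousAt (fun v : ℂ => cauchyTransform ψ (conj v)) z :=
      ContinuousAt.comp (f := fun v : ℂ => conj v)
        (differentiableAt_cauchyTransform hψ hi (by simpa using h0)).continuousAt
        Complex.continuous_conj.continuousAt
    exact (hG.continuous.sub (hG.continuous.comp Complex.continuous_conj)).continuousAt.mul h1

/-- Differentiating a holomorphic function twice along a line. -/
theorem deriv_deriv_comp_line {f : ℂ → ℂ} {U : Set ℂ} (hU : IsOpen U)
    (hf : DifferentiableOn ℂ f U) (a c : ℂ) {x : ℝ} (hx : a + x * c ∈ U) :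
    (∀ᶠ s : ℝ in 𝓝 x, DifferentiableAt ℝ (fun r : ℝ => f (a + r * c)) s) ∧
    HasDerivAt (fun s : ℝ => deriv (fun r : ℝ => f (a + r * c)) s)
      (c ^ 2 * deriv (deriv f) (a + x * c)) x := by
  have hline : ∀ s : ℝ, HasDerivAt (fun r : ℝ => a + r * c) c s := fun s => by
    simpa using ((Complex.ofRealCLM.hasDerivAt (x := s)).mul_const c).const_add a
  have hd : ∀ g : ℂ → ℂ, DifferentiableOn ℂ g U → ∀ s : ℝ, a + s * c ∈ U →
      HasDerivAt (fun r : ℝ => g (a + r * c)) (c * deriv g (a + s * c)) s := by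
    intro g hg s hs
    rw [mul_comm]
    exact HasDerivAt.comp s (hg.differentiableAt (hU.mem_nhds hs)).hasDerivAt (hline s)
  have hev : ∀ᶠ s : ℝ in 𝓝 x, a + s * c ∈ U :=
    (hline x).continuousAt.eventually (hU.mem_nhds hx)
  refine ⟨hev.mono fun s hs => (hd f hf s hs).differentiableAt, ?_⟩
  have h2 := (hd _ (hf.deriv hU) x hx).const_mul c
  rw [← mul_assoc, ← sq] at h2
  exact h2.congr_of_eventuallyEq (hev.mono fun s hs => (hd f hf s hs).deriv)

theorem harmonicOnH_holomorphic_sub_antiholomorphic {f g u : ℂ → ℂ}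
    (hf : DifferentiableOn ℂ f {z | 0 < z.im}) (hg : DifferentiableOn ℂ g {z | z.im < 0})
    (hu : ∀ z : ℂ, 0 < z.im → u z = f z - g (conj z)) : HarmonicOnH u := by
  have hU : IsOpen {z : ℂ | 0 < z.im} := isOpen_lt continuous_const Complex.continuous_im
  have hL : IsOpen {z : ℂ | z.im < 0} := isOpen_lt Complex.continuous_im continuous_const
  have hu' : ∀ x y : ℝ, 0 < y →
      u (x + y * Complex.I) = f (x + y * Complex.I) - g (x + y * -Complex.I) := by
    intro x y hy
    rw [hu _ (by simpa using hy)]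
    simp
  constructor
  · have h1 : ContDiffOn ℝ 2 (fun p : ℝ × ℝ => f (p.1 + p.2 * Complex.I)) {p | 0 < p.2} := by
      refine ((hf.contDiffOn hU).restrict_scalars ℝ).comp
        (t := {z : ℂ | 0 < z.im}) (ContDiff.contDiffOn ?_) fun p hp => by simpa using hp
      exact (Complex.ofRealCLM.contDiff.comp contDiff_fst).add
        ((Complex.ofRealCLM.contDiff.comp contDiff_snd).mul contDiff_const)
    have h2 : ContDiffOn ℝ 2 (fun p : ℝ × ℝ => g (p.1 + p.2 * -Complex.I)) {p | 0 < p.2} := by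
      refine ((hg.contDiffOn hL).restrict_scalars ℝ).comp
        (t := {z : ℂ | z.im < 0}) (ContDiff.contDiffOn ?_) fun p hp => by simpa using hp
      exact (Complex.ofRealCLM.contDiff.comp contDiff_fst).add
        ((Complex.ofRealCLM.contDiff.comp contDiff_snd).mul contDiff_const)
    exact (h1.sub h2).congr fun p hp => hu' _ _ hp
  · intro τ hτ
    obtain ⟨x, y, rfl⟩ : ∃ x y : ℝ, τ = ⟨x, y⟩ := ⟨τ.re, τ.im, rfl⟩
    simp only at hτ ⊢
    have hfx := deriv_deriv_comp_line hU hf (y * Complex.I) 1 (x := x) (by simpa using hτ)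
    have hgx := deriv_deriv_comp_line hL hg (y * -Complex.I) 1 (x := x) (by simpa using hτ)
    have hfy := deriv_deriv_comp_line hU hf x Complex.I (x := y) (by simpa using hτ)
    have hgy := deriv_deriv_comp_line hL hg x (-Complex.I) (x := y) (by simpa using hτ)
    simp only [mul_one, add_comm _ ((_ : ℝ) : ℂ)] at hfx hgx
    have hX : deriv (fun s : ℝ => deriv (fun r : ℝ => u (r + y * Complex.I)) s) x = _ :=
      ((hfx.2.sub hgx.2).congr_of_eventuallyEq <| by
        filter_upwards [hfx.1, hgx.1] with s hs hs'
        rw [Pi.sub_apply, ← deriv_fun_sub hs hs']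
        simp only [hu' _ _ hτ]).deriv
    have hY : deriv (fun s : ℝ => deriv (fun r : ℝ => u (x + r * Complex.I)) s) y = _ :=
      ((hfy.2.sub hgy.2).congr_of_eventuallyEq <| by
        filter_upwards [hfy.1, hgy.1, lt_mem_nhds hτ] with s hs hs' hpos
        rw [Pi.sub_apply, ← deriv_fun_sub hs hs']
        exact Filter.EventuallyEq.deriv_eq
          ((lt_mem_nhds hpos).mono fun r hr => hu' _ _ hr)).deriv
    rw [hX, hY, neg_sq, Complex.I_sq]
    ring

/-- For every continuous `φ : ℝ → ℂ` there is a function `u`,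
continuous on the closed upper half-plane and harmonic on `ℍ`, with `u = φ` on `ℝ`. -/
theorem statement16 (φ : ℝ → ℂ) (hφ : Continuous φ) :
    ∃ u : ℂ → ℂ, ContinuousOn u {τ : ℂ | 0 ≤ τ.im} ∧ HarmonicOnH u ∧
      ∀ t : ℝ, u (t : ℂ) = φ t := by
  obtain ⟨G, hG, hGw⟩ := exists_entire_ge (fun t => (1 + t ^ 2) * ‖φ t‖ + 1) (by fun_prop)
  have hG0 : ∀ t : ℝ, G t ≠ 0 := fun t => norm_pos_iff.mp <|
    (by positivity : 0 < (1 + t ^ 2) * ‖φ t‖ + 1).trans_le (hGw t)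
  set ψ : ℝ → ℂ := fun t => φ t / G t with hψdef
  have hψ : Continuous ψ := hφ.div (hG.continuous.comp Complex.continuous_ofReal) hG0
  have hbd : ∀ t, ‖ψ t‖ ≤ (1 + t ^ 2)⁻¹ := by
    intro t
    rw [norm_div, div_le_iff₀ (norm_pos_iff.mpr (hG0 t)), inv_mul_eq_div,
      le_div_iff₀ (by positivity)]
    linarith [hGw t]
  have hi : Integrable ψ := integrable_inv_one_add_sq.mono' hψ.aestronglyMeasurable
    (.of_forall hbd)
  have hC : ∀ z : ℂ, z.im ≠ 0 → DifferentiableAt ℂ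
      (fun z => (2 * Real.pi * Complex.I)⁻¹ * (G z * cauchyTransform ψ z)) z := fun z hz =>
    ((hG z).mul (differentiableAt_cauchyTransform hψ hi hz)).const_mul _
  refine ⟨fun z => G z * poissonIntegral ψ z + (2 * Real.pi * Complex.I)⁻¹ *
    ((G z - G (conj z)) * cauchyTransform ψ (conj z)), ?_, ?_, ?_⟩
  · refine Continuous.continuousOn ((hG.continuous.mul (continuous_poissonIntegral hψ (M := 1)
      fun t => (hbd t).trans (inv_le_one_of_one_le₀ ?_))).add
      (continuous_const.mul (continuous_sub_conj_mul_cauchyTransform hG hψ hi)))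
    linarith [sq_nonneg t]
  · refine harmonicOnH_holomorphic_sub_antiholomorphic
      (fun z hz => (hC z (ne_of_gt hz)).differentiableWithinAt)
      (fun z hz => (hC z (ne_of_lt hz)).differentiableWithinAt) fun z hz => ?_
    simp only [poissonIntegral_eq_cauchyTransform hψ hi hz]
    ring
  · intro t
    simp [poissonIntegral_ofReal, hψdef, mul_div_cancel₀ _ (hG0 t)]

end
end

section
/- Suppose u : ℍ → ℂ is harmonic, extends continuously to the closed upper half-plane {τ ∈ ℂ : Im τ ≥ 0}, and satisfies u(t) = 0 for every t ∈ ℝ. Then there exist entire functions F₁, F₂ : ℂ → ℂ taking real values on ℝ (equivalently, with real Taylor coefficients at 0) such that u(τ) = Im F₁(τ) + i · Im F₂(τ) for all τ ∈ ℍ. -/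
noncomputable section

open InnerProductSpace Metric Set Filter Topology ComplexConjugate

/-- A real function with a local maximum at a point of harmonicity is locally constant there. -/
theorem InnerProductSpace.HarmonicAt.eventually_eq_of_isLocalMax {h : ℂ → ℝ} {z : ℂ}
    (hh : HarmonicAt h z) (hmax : IsLocalMax h z) : ∀ᶠ y in 𝓝 z, h y = h z := by
  obtain ⟨r, hr, hball⟩ := Metric.isOpen_iff.1 (isOpen_setOfPred_harmonicAt h) z hh
  obtain ⟨F, hF, hFh⟩ :=
    HarmonicOnNhd.exists_analyticOnNhd_ball_re_eq (f := h) (z := z) (R := r) hball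
  have hb : ball z r ∈ 𝓝 z := ball_mem_nhds z hr
  have hre : ∀ y ∈ ball z r, (F y).re = h y := fun y hy => hFh hy
  have hexp : ∀ᶠ y in 𝓝 z, Complex.exp (F y) = Complex.exp (F z) := by
    refine Complex.eventually_eq_of_isLocalMax_norm (f := fun y => Complex.exp (F y)) ?_ ?_
    · filter_upwards [hb] with y hy using (hF y hy).differentiableAt.cexp
    · filter_upwards [hb, hmax] with y hy hyz
      simpa [Complex.norm_exp, hre y hy, hre z (mem_ball_self hr)] using hyz
  filter_upwards [hb, hexp] with y hy hyz
  have := congrArg norm hyz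
  simpa [Complex.norm_exp, hre y hy, hre z (mem_ball_self hr)] using this

/-- Maximum principle on a disk for a continuous function that is harmonic off the real axis. -/
theorem le_of_harmonicAt_off_real {h : ℂ → ℝ} {R ε : ℝ}
    (hc : ContinuousOn h (closedBall 0 R))
    (hh : ∀ z ∈ ball (0 : ℂ) R, z.im ≠ 0 → HarmonicAt h z)
    (hs : ∀ z ∈ sphere (0 : ℂ) R, h z ≤ ε)
    (hr : ∀ z ∈ closedBall (0 : ℂ) R, z.im = 0 → h z ≤ ε) :
    ∀ z ∈ closedBall (0 : ℂ) R, h z ≤ ε := by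
  intro z hz
  by_contra! hlt
  obtain ⟨m, hm, hmax⟩ := (isCompact_closedBall (0 : ℂ) R).exists_isMaxOn ⟨z, hz⟩ hc
  have hgt : ε < h m := hlt.trans_le (hmax hz)
  set K : Set ℂ := {w | w ∈ closedBall (0 : ℂ) R ∧ h w = h m} with hK
  have hclosed : IsClosed K := hc.preimage_isClosed_of_isClosed isClosed_closedBall
    (isClosed_singleton (x := h m))
  have hopen : IsOpen K := by
    refine isOpen_iff_mem_nhds.2 fun w hw => ?_
    have hwim : w.im ≠ 0 := fun h0 => by linarith [hr w hw.1 h0, hw.2]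
    have hwb : w ∈ ball (0 : ℂ) R := by
      refine mem_ball.2 (lt_of_le_of_ne (mem_closedBall.1 hw.1) fun h0 => ?_)
      linarith [hs w h0, hw.2]
    have hnhds : ball (0 : ℂ) R ∈ 𝓝 w := isOpen_ball.mem_nhds hwb
    have hloc : IsLocalMax h w := by
      filter_upwards [hnhds] with y hy
      rw [hw.2]
      exact hmax (ball_subset_closedBall hy)
    filter_upwards [hnhds, (hh w hwb hwim).eventually_eq_of_isLocalMax hloc] with y hy hyw
    exact ⟨ball_subset_closedBall hy, hyw.trans hw.2⟩
  have huniv : K = univ := IsClopen.eq_univ ⟨hclosed, hopen⟩ ⟨m, hm, rfl⟩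
  have h0 : (0 : ℂ) ∈ K := huniv ▸ mem_univ _
  linarith [hr 0 h0.1 rfl, h0.2]

/-- Continuous functions are approximated on a circle by real parts of entire functions. -/
theorem exists_differentiable_abs_re_sub_lt {v : ℂ → ℝ} (hv : Continuous v) {R ε : ℝ}
    (hR : 0 < R) (hε : 0 < ε) :
    ∃ G : ℂ → ℂ, Differentiable ℂ G ∧ ∀ z ∈ sphere (0 : ℂ) R, |(G z).re - v z| < ε := by
  have : Fact ((0 : ℝ) < 1) := ⟨one_pos⟩
  let e : AddCircle (1 : ℝ) → ℂ := fun t => (AddCircle.toCircle t : ℂ)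
  have he : Continuous e := continuous_subtype_val.comp AddCircle.continuous_toCircle
  let S : Submodule ℂ C(AddCircle (1 : ℝ), ℂ) :=
    { carrier := {g | ∃ p q : ℂ → ℂ, Differentiable ℂ p ∧ Differentiable ℂ q ∧
        ∀ t, g t = p (e t) + conj (q (e t))}
      add_mem' := by
        rintro g₁ g₂ ⟨p₁, q₁, hp₁, hq₁, h₁⟩ ⟨p₂, q₂, hp₂, hq₂, h₂⟩
        refine ⟨p₁ + p₂, q₁ + q₂, hp₁.add hp₂, hq₁.add hq₂, fun t => ?_⟩
        simp only [ContinuousMap.add_apply, h₁, h₂, Pi.add_apply, map_add]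
        ring
      zero_mem' := ⟨0, 0, differentiable_const _, differentiable_const _, fun t => by simp⟩
      smul_mem' := by
        rintro c g ⟨p, q, hp, hq, h⟩
        refine ⟨c • p, conj c • q, hp.const_smul c, hq.const_smul _, fun t => ?_⟩
        simp only [ContinuousMap.smul_apply, h, Pi.smul_apply, smul_eq_mul, map_mul,
          Complex.conj_conj]
        ring }
  have hS : Submodule.span ℂ (range (@fourier (1 : ℝ))) ≤ S := by
    refine Submodule.span_le.2 ?_
    rintro _ ⟨n, rfl⟩
    have hn : ∀ t, fourier n t = e t ^ n := fun t => by
      simp [e, fourier_apply, AddCircle.toCircle_zsmul]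
    obtain ⟨k, rfl | rfl⟩ := n.eq_nat_or_neg
    · exact ⟨fun z => z ^ k, 0, differentiable_id.pow k, differentiable_const _, fun t => by
        rw [hn]; simp⟩
    · refine ⟨0, fun z => z ^ k, differentiable_const _, differentiable_id.pow k, fun t => ?_⟩
      have hconj : conj (e t) = (e t)⁻¹ := (Circle.coe_inv_eq_conj _).symm.trans (Circle.coe_inv _)
      rw [hn]
      simp [hconj]
  let g : C(AddCircle (1 : ℝ), ℂ) :=
    ⟨fun t => (v (R * e t) : ℂ), by fun_prop⟩
  have hg : g ∈ (Submodule.span ℂ (range (@fourier (1 : ℝ)))).topologicalClosure := by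
    rw [span_fourier_closure_eq_top]; trivial
  obtain ⟨f, hf, hfg⟩ := Metric.mem_closure_iff.1 hg ε hε
  obtain ⟨p, q, hp, hq, hpq⟩ := hS hf
  refine ⟨fun z => p (z / R) + q (z / R), by fun_prop, fun z hz => ?_⟩
  have hz' : ‖z‖ = R := by simpa using hz
  have hR0 : (R : ℂ) ≠ 0 := by exact_mod_cast hR.ne'
  have hcirc : z / R ∈ Submonoid.unitSphere ℂ := by
    simp [Submonoid.unitSphere, hz', abs_of_pos hR, hR.ne']
  obtain ⟨t, ht⟩ := (AddCircle.homeomorphCircle (one_ne_zero (α := ℝ))).surjective ⟨z / R, hcirc⟩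
  have het : e t = z / R := by
    have := congrArg (fun c : Circle => (c : ℂ)) ht
    simpa [e, AddCircle.homeomorphCircle_apply] using this
  have hlt : ‖f t - g t‖ < ε := by
    rw [← dist_eq_norm, dist_comm]
    exact (ContinuousMap.dist_apply_le_dist t).trans_lt hfg
  refine lt_of_eq_of_lt (congrArg abs ?_) ((Complex.abs_re_le_norm _).trans_lt hlt)
  simp [g, hpq, het, mul_div_cancel₀ z hR0]

/-- Approximation of a conjugation-odd continuous function on a circle by conjugation-odd real
parts of entire functions. -/
theorem exists_differentiable_odd_abs_re_sub_lt {v : ℂ → ℝ} (hv : Continuous v)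
    (hodd : ∀ z, v (conj z) = -v z) {R ε : ℝ} (hR : 0 < R) (hε : 0 < ε) :
    ∃ G : ℂ → ℂ, Differentiable ℂ G ∧ (∀ z, z.im = 0 → (G z).re = 0) ∧
      ∀ z ∈ sphere (0 : ℂ) R, |(G z).re - v z| < ε := by
  obtain ⟨P, hP, hPv⟩ := exists_differentiable_abs_re_sub_lt hv hR hε
  refine ⟨fun z => (P z - conj (P (conj z))) / 2,
    (hP.sub fun z => differentiableAt_conj_conj_iff.2 (hP (conj z))).div_const 2, fun z hz => ?_, fun z hz => ?_⟩
  · simp [Complex.conj_eq_iff_im.2 hz]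
  · have h₁ := abs_lt.1 (hPv z hz)
    have h₂ := abs_lt.1 (hPv (conj z) (by simpa using hz))
    rw [hodd] at h₂
    have : ((P z - conj (P (conj z))) / 2).re = ((P z).re - (P (conj z)).re) / 2 := by simp
    rw [this]
    exact abs_lt.2 ⟨by linarith [h₁.1, h₂.2], by linarith [h₁.2, h₂.1]⟩

theorem circleAverage_herglotz_le_of_odd {v : ℂ → ℝ} (hv : Continuous v)
    (hodd : ∀ z, v (conj z) = -v z) (hh : ∀ z : ℂ, z.im ≠ 0 → HarmonicAt v z)
    {R : ℝ} {w : ℂ} (hw : w ∈ ball (0 : ℂ) R) :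
    Real.circleAverage ((Complex.re ∘ herglotzRieszKernel 0 w) • v) 0 R ≤ v w := by
  have hR : 0 < R := pos_of_mem_ball hw
  refine le_of_forall_pos_le_add fun ε hε => ?_
  obtain ⟨G, hG, hGreal, hGv⟩ := exists_differentiable_odd_abs_re_sub_lt hv hodd hR (half_pos hε)
  have hGan : ∀ z, AnalyticAt ℂ G z := fun z => hG.analyticAt z
  have hvreal : ∀ z : ℂ, z.im = 0 → v z = 0 := fun z hz => by
    have := hodd z
    rw [Complex.conj_eq_iff_im.2 hz] at this
    linarith
  have hGw : (G w).re - v w ≤ ε / 2 := by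
    refine le_of_harmonicAt_off_real (h := fun z => (G z).re - v z) (R := R) ?_ ?_ ?_ ?_ w
      (ball_subset_closedBall hw)
    · exact ((Complex.continuous_re.comp hG.continuous).sub hv).continuousOn
    · exact fun z _ hz => (hGan z).harmonicAt_re.sub (hh z hz)
    · exact fun z hz => (le_abs_self _).trans (hGv z hz).le
    · intro z _ hz
      simp only [hGreal z hz, hvreal z hz]
      linarith
  have hGε : HarmonicOnNhd (fun z => (G z + (ε / 2 : ℝ)).re) (closedBall 0 R) :=
    fun z _ => ((hGan z).add analyticAt_const).harmonicAt_re
  have hker : ContinuousOn (Complex.re ∘ herglotzRieszKernel 0 w) (sphere 0 |R|) :=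
    Complex.continuous_re.comp_continuousOn (continuousOn_herglotzRieszKernel_sphere hw)
  calc Real.circleAverage ((Complex.re ∘ herglotzRieszKernel 0 w) • v) 0 R
      ≤ Real.circleAverage ((Complex.re ∘ herglotzRieszKernel 0 w) •
          fun z => (G z + (ε / 2 : ℝ)).re) 0 R := by
        refine Real.circleAverage_mono ?_ ?_ fun z hz => ?_
        · exact (hker.smul hv.continuousOn).circleIntegrable'
        · refine (hker.smul (Continuous.continuousOn ?_)).circleIntegrable'
          exact Complex.continuous_re.comp (hG.continuous.add continuous_const)
        · rw [abs_of_pos hR] at hz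
          refine mul_le_mul_of_nonneg_left ?_ ?_
          · have := (abs_lt.1 (hGv z hz)).1
            simp only [Complex.add_re, Complex.ofReal_re]
            linarith
          · refine le_trans ?_ (le_re_herglotzRieszKernel hz hw)
            have : ‖w - 0‖ < R := by simpa using hw
            exact div_nonneg (by linarith) (by positivity)
    _ = (G w + (ε / 2 : ℝ)).re := hGε.circleAverage_re_herglotzRieszKernel_smul hw
    _ ≤ v w + ε := by
        simp only [Complex.add_re, Complex.ofReal_re]
        linarith

/-- **Schwarz reflection**: a continuous conjugation-odd function that is harmonic off the real
axis is harmonic everywhere. -/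
theorem harmonicAt_of_odd {v : ℂ → ℝ} (hv : Continuous v)
    (hodd : ∀ z, v (conj z) = -v z) (hh : ∀ z : ℂ, z.im ≠ 0 → HarmonicAt v z) (w : ℂ) :
    HarmonicAt v w := by
  set R : ℝ := ‖w‖ + 1
  have hwR : w ∈ ball (0 : ℂ) R := by simp [R]
  have hint : CircleIntegrable v 0 R := hv.continuousOn.circleIntegrable'
  have hint' : CircleIntegrable (fun z => (v z : ℂ)) 0 R :=
    (Complex.continuous_ofReal.comp hv).continuousOn.circleIntegrable'
  have hrep : ∀ y ∈ ball (0 : ℂ) R, v y =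
      (Real.circleAverage (fun ζ => herglotzRieszKernel 0 y ζ • (v ζ : ℂ)) 0 R).re := by
    intro y hy
    rw [re_circleAverage_herglotzRieszKernel_smul hint hy]
    refine le_antisymm ?_ (circleAverage_herglotz_le_of_odd hv hodd hh hy)
    have hneg := circleAverage_herglotz_le_of_odd (v := -v) hv.neg (by simp [hodd])
      (fun z hz => (hh z hz).neg) hy
    have hsmul : (Complex.re ∘ herglotzRieszKernel 0 y) • (-v) =
        (-1 : ℝ) • ((Complex.re ∘ herglotzRieszKernel 0 y) • v) := by
      ext z; simp
    rw [hsmul, Real.circleAverage_smul] at hneg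
    rw [neg_one_smul, Pi.neg_apply] at hneg
    linarith
  refine (harmonicAt_congr_nhds ?_).2
    (analyticOnNhd_circleAverage_herglotzRieszKernel_smul hint' w hwR).harmonicAt_re
  filter_upwards [isOpen_ball.mem_nhds hwR] with y hy using hrep y hy

theorem InnerProductSpace.HarmonicAt.neg_comp_conj {f : ℂ → ℝ} {z : ℂ}
    (hf : HarmonicAt f (conj z)) : HarmonicAt (fun w => -f (conj w)) z := by
  obtain ⟨r, hr, hball⟩ := Metric.isOpen_iff.1 (isOpen_setOfPred_harmonicAt f) _ hf
  obtain ⟨F, hF, hFf⟩ :=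
    HarmonicOnNhd.exists_analyticOnNhd_ball_re_eq (f := f) (z := conj z) (R := r) hball
  have hmem : ∀ w ∈ ball z r, conj w ∈ ball (conj z) r := fun w hw => by
    rw [mem_ball, Complex.dist_conj_conj]; exact hw
  have hdiff : DifferentiableOn ℂ (fun w => -conj (F (conj w))) (ball z r) := fun w hw =>
    (differentiableAt_conj_conj_iff.2 (hF _ (hmem w hw)).differentiableAt).neg.differentiableWithinAt
  refine (harmonicAt_congr_nhds ?_).2
    (hdiff.analyticAt (ball_mem_nhds z hr)).harmonicAt_re
  filter_upwards [ball_mem_nhds z hr] with w hw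
  have : (F (conj w)).re = f (conj w) := hFf (hmem w hw)
  simp [this]

/-- A function harmonic in the open upper half-plane, continuous up to the real axis and vanishing
on it, is the imaginary part of an entire function. -/
theorem exists_entire_im_eq {f : ℂ → ℝ} (hf : ∀ z : ℂ, 0 < z.im → HarmonicAt f z)
    (hc : ContinuousOn f {z : ℂ | 0 ≤ z.im}) (h0 : ∀ t : ℝ, f (t : ℂ) = 0) :
    ∃ F : ℂ → ℂ, Differentiable ℂ F ∧ (∀ x : ℝ, (F (x : ℂ)).im = 0) ∧
      ∀ z : ℂ, 0 < z.im → (F z).im = f z := by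
  let g : ℂ → ℝ := fun z => f (z.re + |z.im| * Complex.I)
  have hg : Continuous g := by
    refine hc.comp_continuous (by fun_prop) fun z => ?_
    simp
  have hgr : ∀ z : ℂ, z.im = 0 → g z = 0 := fun z hz => by simp [g, hz, h0]
  let v : ℂ → ℝ := fun z => if 0 ≤ z.im then g z else -g z
  have hv : Continuous v := by
    refine Continuous.if_le hg hg.neg continuous_const Complex.continuous_im fun z hz => ?_
    simp [hgr z hz.symm]
  have hpos : ∀ z : ℂ, 0 ≤ z.im → v z = f z := fun z hz => by
    simp [v, g, hz, abs_of_nonneg hz]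
  have hodd : ∀ z, v (conj z) = -v z := fun z => by
    have hgc : g (conj z) = g z := by simp [g]
    rcases lt_trichotomy z.im 0 with h | h | h
    · simp [v, hgc, h.le, h.not_ge]
    · simp [v, hgc, h, hgr z h]
    · simp [v, hgc, h.le, h.not_ge]
  have hh : ∀ z : ℂ, z.im ≠ 0 → HarmonicAt v z := by
    intro z hz
    rcases lt_or_gt_of_ne hz with h | h
    · have hz' : 0 < (conj z).im := by simpa using h
      refine (harmonicAt_congr_nhds ?_).2 (hf _ hz').neg_comp_conj
      filter_upwards [(isOpen_lt Complex.continuous_im continuous_const).mem_nhds h] with w hw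
      have hw' : 0 ≤ (conj w).im := by
        have : w.im < 0 := hw
        simpa using this.le
      rw [← hpos _ hw', hodd, neg_neg]
    · refine (harmonicAt_congr_nhds ?_).2 (hf z h)
      filter_upwards [(isOpen_lt continuous_const Complex.continuous_im).mem_nhds h] with w hw
      exact hpos w (le_of_lt hw)
  obtain ⟨F, hF, hFv⟩ := HarmonicOnNhd.exists_analyticOnNhd_univ_re_eq (f := v)
    fun w _ => harmonicAt_of_odd hv hodd hh w
  have hre : ∀ z, (F z).re = v z := fun z => congrFun hFv z
  refine ⟨fun z => Complex.I * F z, fun z => ((hF z (mem_univ z)).differentiableAt.const_mul _),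
    fun x => ?_, fun z hz => ?_⟩
  · simp [hre, hpos, h0]
  · simp [hre, hpos z hz.le]

/-- Differentiating twice along a real line computes a diagonal value of the second derivative. -/
theorem deriv_deriv_comp_line_s17 {h : ℂ → ℂ} {c d : ℂ} {t : ℝ}
    (hh : ContDiffAt ℝ 2 h (c + t * d)) :
    deriv (fun s : ℝ => deriv (fun s' : ℝ => h (c + s' * d)) s) t =
      fderiv ℝ (fderiv ℝ h) (c + t * d) d d := by
  have hline : ∀ s : ℝ, HasDerivAt (fun s' : ℝ => c + s' * d) d s := fun s => by
    simpa using ((Complex.ofRealCLM.hasDerivAt (x := s)).mul_const d).const_add c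
  have hev : ∀ᶠ s in 𝓝 t, deriv (fun s' : ℝ => h (c + s' * d)) s =
      fderiv ℝ h (c + s * d) d := by
    filter_upwards [(hline t).continuousAt.eventually (hh.eventually (by simp))] with s hs
    exact ((hs.differentiableAt two_ne_zero).hasFDerivAt.comp_hasDerivAt s (hline s)).deriv
  rw [Filter.EventuallyEq.deriv_eq hev]
  have hd : DifferentiableAt ℝ (fderiv ℝ h) (c + t * d) :=
    (hh.fderiv_right (m := 1) (by norm_num)).differentiableAt one_ne_zero
  have hd' : HasDerivAt (fun s : ℝ => fderiv ℝ h (c + s * d))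
      (fderiv ℝ (fderiv ℝ h) (c + t * d) d) t :=
    hd.hasFDerivAt.comp_hasDerivAt t (hline t)
  exact ((ContinuousLinearMap.apply ℝ ℂ d).hasFDerivAt.comp_hasDerivAt t hd').deriv

theorem HarmonicOnH.harmonicAt {u : ℂ → ℂ} (hu : HarmonicOnH u) {z : ℂ} (hz : 0 < z.im) :
    HarmonicAt u z := by
  have hcd : ∀ w : ℂ, 0 < w.im → ContDiffAt ℝ 2 u w := fun w hw => by
    have hp : ContDiffAt ℝ 2 (fun p : ℝ × ℝ => u ((p.1 : ℂ) + (p.2 : ℂ) * Complex.I))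
        (Complex.equivRealProdCLM w) :=
      hu.1.contDiffAt ((isOpen_lt continuous_const continuous_snd).mem_nhds hw)
    have := hp.comp w Complex.equivRealProdCLM.contDiff.contDiffAt
    refine this.congr_of_eventuallyEq (Eventually.of_forall fun y => ?_)
    simp [Complex.re_add_im]
  refine ⟨hcd z hz, ?_⟩
  filter_upwards [(isOpen_lt continuous_const Complex.continuous_im).mem_nhds hz] with w hw
  have hlap := hu.2 w hw
  have e₁ : w.im * Complex.I + w.re * 1 = w := by rw [mul_one, add_comm, Complex.re_add_im]
  have h₁ := deriv_deriv_comp_line_s17 (h := u) (c := w.im * Complex.I) (d := 1) (t := w.re)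
    (by rw [e₁]; exact hcd w hw)
  have h₂ := deriv_deriv_comp_line_s17 (h := u) (c := w.re) (d := Complex.I) (t := w.im)
    (by rw [Complex.re_add_im]; exact hcd w hw)
  rw [e₁] at h₁
  rw [Complex.re_add_im] at h₂
  rw [h₂] at hlap
  simp only [mul_one, add_comm ((w.im : ℂ) * Complex.I)] at h₁
  rw [h₁] at hlap
  simpa [laplacian_eq_iteratedFDeriv_complexPlane, iteratedFDeriv_two_apply] using hlap

/-- If `u : ℍ → ℂ` is harmonic, extends continuously to the closed
upper half-plane, and vanishes on `ℝ`, then there are entire functions `F₁, F₂` taking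
real values on `ℝ` with `u(τ) = Im F₁(τ) + i · Im F₂(τ)` on `ℍ`. -/
theorem statement17 (u : ℂ → ℂ)
    (hharm : HarmonicOnH u)
    (hcont : ContinuousOn u {τ : ℂ | 0 ≤ τ.im})
    (hzero : ∀ t : ℝ, u (t : ℂ) = 0) :
    ∃ F₁ F₂ : ℂ → ℂ, Differentiable ℂ F₁ ∧ Differentiable ℂ F₂ ∧
      (∀ x : ℝ, (F₁ (x : ℂ)).im = 0) ∧ (∀ x : ℝ, (F₂ (x : ℂ)).im = 0) ∧
      ∀ τ : ℂ, 0 < τ.im →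
        u τ = (((F₁ τ).im : ℝ) : ℂ) + Complex.I * (((F₂ τ).im : ℝ) : ℂ) := by
  have hre : ∀ z : ℂ, 0 < z.im → HarmonicAt (fun z => (u z).re) z := fun z hz =>
    (hharm.harmonicAt hz).comp_CLM Complex.reCLM
  have him : ∀ z : ℂ, 0 < z.im → HarmonicAt (fun z => (u z).im) z := fun z hz =>
    (hharm.harmonicAt hz).comp_CLM Complex.imCLM
  obtain ⟨F₁, hF₁, hr₁, hu₁⟩ := exists_entire_im_eq hre
    (Complex.continuous_re.comp_continuousOn hcont) (by simp [hzero])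
  obtain ⟨F₂, hF₂, hr₂, hu₂⟩ := exists_entire_im_eq him
    (Complex.continuous_im.comp_continuousOn hcont) (by simp [hzero])
  refine ⟨F₁, F₂, hF₁, hF₂, hr₁, hr₂, fun τ hτ => ?_⟩
  rw [hu₁ τ hτ, hu₂ τ hτ, mul_comm, Complex.re_add_im]

end
end

section
/- Let φ ∈ L¹(ℝ) and define u(x, y) := ∫_ℝ e^{i(xt + y/t)} φ(t) dt for (x, y) ∈ ℝ². Then for every y ≤ 0 the improper integral ∫₀^{+∞} J₁(−y, t) u(t, 0) dt = lim_{R→+∞} ∫₀^{R} J₁(−y, t) u(t, 0) dt exists and u(0, y) = u(0, 0) − ∫₀^{+∞} J₁(−y, t) u(t, 0) dt. -/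
open MeasureTheory Filter

noncomputable section

/-- The `L¹`-mixed bounded exponential solution
`u(x, y) = ∫_ℝ e^{i(xt + y/t)} φ(t) dt` of the Klein-Gordon equation. -/
def KGsol (φ : ℝ → ℂ) (x y : ℝ) : ℂ :=
  ∫ t : ℝ, Complex.exp (Complex.I * ((x : ℂ) * (t : ℂ) + (y : ℂ) / (t : ℂ))) * φ t

/-- The two-variable Bessel-type function
`J₁(x, y) = Σ_{k≥0} ((−1)^k / (k!(k+1)!)) x^{k+1} y^k`. -/
def J1fun (x y : ℝ) : ℝ :=
  ∑' k : ℕ, ((-1 : ℝ) ^ k / ((Nat.factorial k : ℝ) * (Nat.factorial (k + 1) : ℝ)))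
    * x ^ (k + 1) * y ^ k

open Complex

/-- Rewriting a circle integral around the origin as an integral in the angle. -/
theorem circleIntegral_inv_smul_eq (g : ℂ → ℂ) {c : ℝ} (hc : 0 < c) :
    (∮ w in C(0, c), w⁻¹ * g w) = I * ∫ θ in (0 : ℝ)..2 * Real.pi, g (circleMap 0 c θ) := by
  rw [circleIntegral, ← intervalIntegral.integral_const_mul]
  congr 1
  ext θ
  have h : circleMap 0 c θ ≠ 0 := circleMap_ne_center hc.ne'
  simp only [deriv_circleMap, smul_eq_mul]
  field_simp

theorem ne_zero_of_mem_sphere_zero {c : ℝ} (hc : 0 < c) {w : ℂ} (hw : w ∈ Metric.sphere (0 : ℂ) c) :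
    w ≠ 0 := by
  rintro rfl
  simp at hw
  exact hc.ne hw

theorem circleIntegral_exp_mul_inv_pow (s : ℂ) {c : ℝ} (hc : 0 < c) (k : ℕ) :
    (∮ w in C(0, c), exp (s * w) * (w⁻¹) ^ (k + 1)) =
      2 * Real.pi * I * (s ^ k / (k.factorial : ℂ)) := by
  induction k with
  | zero =>
    have h := DifferentiableOn.circleIntegral_sub_inv_smul (R := c) (c := 0) (w := 0)
      (f := fun w => exp (s * w)) (by fun_prop) (by simpa using hc)
    simpa [mul_comm] using h
  | succ k ih =>
    have hci : ∀ n : ℕ, CircleIntegrable (fun w => exp (s * w) * (w⁻¹) ^ n) 0 c := fun n => by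
      refine ContinuousOn.circleIntegrable hc.le ?_
      intro w hw
      have := ne_zero_of_mem_sphere_zero hc hw
      exact ContinuousAt.continuousWithinAt (by fun_prop (disch := assumption))
    have h := circleIntegral.integral_eq_zero_of_hasDerivWithinAt (c := 0) (R := c)
      (f := fun w => exp (s * w) * (w⁻¹) ^ (k + 1))
      (f' := fun w => s * (exp (s * w) * (w⁻¹) ^ (k + 1)) -
        ((k : ℂ) + 1) * (exp (s * w) * (w⁻¹) ^ (k + 2))) hc.le (by
        intro w hw
        have hw0 := ne_zero_of_mem_sphere_zero hc hw
        refine HasDerivAt.hasDerivWithinAt ?_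
        have h1 : HasDerivAt (fun w => exp (s * w)) (exp (s * w) * s) w := by
          simpa using ((hasDerivAt_id w).const_mul s).cexp
        have h2 := (hasDerivAt_inv hw0).pow (k + 1)
        refine (h1.mul h2).congr_deriv ?_
        simp only [Pi.pow_apply, Nat.add_sub_cancel, inv_pow]
        push_cast
        field_simp
        ring)
    rw [circleIntegral.integral_sub (by simpa using (hci (k + 1)).const_fun_smul (a := s))
      (by simpa using (hci (k + 2)).const_fun_smul (a := (k : ℂ) + 1)), circleIntegral.integral_const_mul,
      circleIntegral.integral_const_mul, ih, sub_eq_zero] at h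
    have hk : (k : ℂ) + 1 ≠ 0 := by exact_mod_cast Nat.succ_ne_zero k
    have hf : (k.factorial : ℂ) ≠ 0 := by exact_mod_cast k.factorial_ne_zero
    rw [show k + 1 + 1 = k + 2 from rfl]
    apply mul_left_cancel₀ hk
    rw [← h, Nat.factorial_succ]
    push_cast
    field_simp
    ring

theorem integral_exp_mul_inv_pow_circleMap (s : ℂ) {c : ℝ} (hc : 0 < c) (k : ℕ) :
    (∫ θ in (0 : ℝ)..2 * Real.pi, exp (s * circleMap 0 c θ) * ((circleMap 0 c θ)⁻¹) ^ k) =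
      2 * Real.pi * (s ^ k / (k.factorial : ℂ)) := by
  have h := circleIntegral_inv_smul_eq (fun w => exp (s * w) * w⁻¹ ^ k) hc
  have h2 := circleIntegral_exp_mul_inv_pow s hc k
  apply mul_left_cancel₀ I_ne_zero
  rw [← h]
  refine Eq.trans ?_ (h2.trans ?_)
  · congr 1; ext w; ring
  · ring

theorem J1fun_eq_integral (s t : ℝ) {c : ℝ} (hc : 0 < c) :
    ((J1fun s t : ℝ) : ℂ) = (2 * Real.pi : ℂ)⁻¹ * ∫ θ in (0 : ℝ)..2 * Real.pi,
      exp (s * circleMap 0 c θ - t * (circleMap 0 c θ)⁻¹) * (circleMap 0 c θ)⁻¹ := by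
  have hcm : Continuous fun θ => circleMap 0 c θ := continuous_circleMap 0 c
  have hci : Continuous fun θ => (circleMap 0 c θ)⁻¹ :=
    hcm.inv₀ fun θ => circleMap_ne_center hc.ne'
  have h := intervalIntegral.hasSum_integral_of_dominated_convergence (μ := volume)
    (a := 0) (b := 2 * Real.pi)
    (F := fun (k : ℕ) θ => ((-t : ℂ) ^ k / (k.factorial : ℂ)) *
      (exp (s * circleMap 0 c θ) * ((circleMap 0 c θ)⁻¹) ^ (k + 1)))
    (f := fun θ => exp (s * circleMap 0 c θ - t * (circleMap 0 c θ)⁻¹) * (circleMap 0 c θ)⁻¹)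
    (bound := fun k _ => ((|t| * c⁻¹) ^ k / (k.factorial : ℝ)) * (Real.exp (|s| * c) * c⁻¹))
    (fun k => by
      apply Continuous.aestronglyMeasurable
      fun_prop)
    (fun k => ae_of_all _ fun θ _ => by
      have h1 : ‖exp (s * circleMap 0 c θ)‖ ≤ Real.exp (|s| * c) := by
        refine (norm_exp_le_exp_norm _).trans ?_
        simp [abs_of_pos hc]
      simp only [norm_mul, norm_div, norm_pow, norm_neg, norm_inv, norm_real, norm_natCast,
        norm_circleMap_zero, abs_of_pos hc, Real.norm_eq_abs]
      calc |t| ^ k / (k.factorial : ℝ) * (‖exp (s * circleMap 0 c θ)‖ * c⁻¹ ^ (k + 1))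
          ≤ |t| ^ k / (k.factorial : ℝ) * (Real.exp (|s| * c) * c⁻¹ ^ (k + 1)) := by gcongr
        _ = _ := by ring)
    (ae_of_all _ fun θ _ => (Real.summable_pow_div_factorial _).mul_right _)
    intervalIntegrable_const
    (ae_of_all _ fun θ _ => by
      have h1 := (NormedSpace.expSeries_div_hasSum_exp (𝔸 := ℂ) (-t * (circleMap 0 c θ)⁻¹)).mul_left
        (exp (s * circleMap 0 c θ) * (circleMap 0 c θ)⁻¹)
      convert h1 using 1
      · rfl
      · ext k; rw [mul_pow]; ring
      · rw [← exp_eq_exp_ℂ, sub_eq_add_neg, exp_add, neg_mul]; ring)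
  simp only [intervalIntegral.integral_const_mul, integral_exp_mul_inv_pow_circleMap _ hc] at h
  have h2 := h.mul_left (2 * Real.pi : ℂ)⁻¹
  rw [← h2.tsum_eq, J1fun, ofReal_tsum]
  congr 1
  ext k
  have hp : (Real.pi : ℂ) ≠ 0 := by exact_mod_cast Real.pi_ne_zero
  push_cast
  rw [neg_pow (t : ℂ)]
  field_simp

theorem circleIntegral_exp_div_sub (s : ℂ) {c : ℝ} (hc : 0 < c) (w₀ : ℂ) (h : ‖w₀‖ ≠ c) :
    (∮ w in C(0, c), (w - w₀)⁻¹ * exp (s * w)) =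
      2 * Real.pi * I * (if ‖w₀‖ < c then exp (s * w₀) else 0) := by
  split_ifs with h1
  · have h := DifferentiableOn.circleIntegral_sub_inv_smul (R := c) (c := 0) (w := w₀)
      (f := fun w => exp (s * w)) (by fun_prop) (by simpa using h1)
    simpa using h
  · rw [mul_zero]
    refine DiffContOnCl.circleIntegral_eq_zero hc.le ?_
    refine DifferentiableOn.diffContOnCl ?_
    rw [closure_ball _ hc.ne']
    intro w hw
    have : w - w₀ ≠ 0 := by
      intro h2
      rw [sub_eq_zero] at h2
      subst h2
      simp at hw
      exact h (le_antisymm hw (not_lt.1 h1))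
    exact DifferentiableAt.differentiableWithinAt (by fun_prop (disch := assumption))

theorem I_mul_circleMap_sub_one_ne_zero {c ξ : ℝ} (hc : 0 < c) (h : |ξ| * c ≠ 1) (θ : ℝ) :
    I * ξ * circleMap 0 c θ - 1 ≠ 0 := by
  intro h2
  rw [sub_eq_zero] at h2
  apply h
  have := congrArg norm h2
  simpa [abs_of_pos hc] using this

theorem integral_exp_div_circleMap (s : ℂ) {c ξ : ℝ} (hc : 0 < c) (hξ : ξ ≠ 0) (h : |ξ| * c ≠ 1) :
    (∫ θ in (0 : ℝ)..2 * Real.pi,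
      exp (s * circleMap 0 c θ) * (I * ξ * circleMap 0 c θ - 1)⁻¹) =
      2 * Real.pi * (-1 + if 1 < |ξ| * c then exp (s * (I * ξ)⁻¹) else 0) := by
  have hξ' : I * (ξ : ℂ) ≠ 0 := mul_ne_zero I_ne_zero (by exact_mod_cast hξ)
  have hn : ‖(I * (ξ : ℂ))⁻¹‖ = |ξ|⁻¹ := by simp
  have hpos : 0 < |ξ| := abs_pos.2 hξ
  have h1 := circleIntegral_exp_div_sub s hc (I * ξ)⁻¹ (by
    rw [hn]; intro h2; apply h; rw [← h2]; field_simp)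
  have h0 := circleIntegral_exp_div_sub s hc 0 (by simpa using hc.ne)
  simp only [hn, inv_lt_iff_one_lt_mul₀ hpos, mul_comm c] at h1
  rw [norm_zero, if_pos hc, mul_zero, exp_zero] at h0
  apply mul_left_cancel₀ I_ne_zero
  rw [← circleIntegral_inv_smul_eq (fun w => exp (s * w) * (I * ξ * w - 1)⁻¹) hc]
  have hw0 : ∀ w ∈ Metric.sphere (0 : ℂ) c, w - (I * ξ)⁻¹ ≠ 0 := by
    intro w hw h2
    rw [sub_eq_zero] at h2
    subst h2
    simp only [mem_sphere_zero_iff_norm, hn] at hw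
    apply h; rw [← hw]; field_simp
  have e : (∮ w in C(0, c), w⁻¹ * (exp (s * w) * (I * ξ * w - 1)⁻¹)) =
      ∮ w in C(0, c), ((w - (I * ξ)⁻¹)⁻¹ * exp (s * w) - (w - 0)⁻¹ * exp (s * w)) := by
    refine circleIntegral.integral_congr hc.le fun w hw => ?_
    have a := ne_zero_of_mem_sphere_zero hc hw
    have b := hw0 w hw
    have b' : I * ξ * w - 1 ≠ 0 := by
      intro h2
      apply b
      rw [sub_eq_zero] at h2 ⊢
      exact eq_inv_of_mul_eq_one_right h2
    have e1 : (w - (I * ξ)⁻¹)⁻¹ = I * ξ * (I * ξ * w - 1)⁻¹ := by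
      have e2 : I * ξ * w - 1 = I * ξ * (w - (I * ξ)⁻¹) := by
        rw [mul_sub, mul_inv_cancel₀ hξ']
      rw [e2, mul_inv (I * (ξ : ℂ)) (w - _), mul_inv_cancel_left₀ hξ']
    have e3 : w⁻¹ * (I * ξ * w - 1)⁻¹ = I * ξ * (I * ξ * w - 1)⁻¹ - w⁻¹ := by
      rw [eq_sub_iff_add_eq]
      apply mul_right_cancel₀ b'
      rw [add_mul, mul_assoc, inv_mul_cancel₀ b', mul_assoc (I * ξ), inv_mul_cancel₀ b']
      field_simp
      ring
    simp only [e1, sub_zero]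
    rw [← sub_mul, ← e3]
    ring
  rw [e, circleIntegral.integral_sub, h1, h0]
  · ring
  · refine ContinuousOn.circleIntegrable hc.le fun w hw => ?_
    have := hw0 w hw
    exact ContinuousAt.continuousWithinAt (by fun_prop (disch := assumption))
  · refine ContinuousOn.circleIntegrable hc.le fun w hw => ?_
    have : w - 0 ≠ 0 := by simpa using ne_zero_of_mem_sphere_zero hc hw
    exact ContinuousAt.continuousWithinAt (by fun_prop (disch := assumption))

theorem circleMap_zero_pi_sub (c θ : ℝ) :
    circleMap 0 c (Real.pi - θ) = -(starRingEnd ℂ) (circleMap 0 c θ) := by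
  simp only [circleMap_zero, map_mul, conj_ofReal, ← exp_conj, conj_I]
  push_cast
  rw [sub_mul, sub_eq_add_neg, exp_add, exp_pi_mul_I]
  ring_nf

theorem continuous_I_mul_circleMap_sub_one_inv {c ξ : ℝ} (hc : 0 < c) (h : |ξ| * c ≠ 1) :
    Continuous fun θ => (I * ξ * circleMap 0 c θ - 1)⁻¹ := by
  have hcm : Continuous fun θ => circleMap 0 c θ := continuous_circleMap 0 c
  exact Continuous.inv₀ (by fun_prop) (I_mul_circleMap_sub_one_ne_zero hc h)

/-- The real part of the Cauchy kernel is a Poisson kernel up to an additive constant. -/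
theorem re_inv_I_mul_circleMap_sub_one {c ξ : ℝ} (hc : 0 < c) (h : |ξ| * c ≠ 1) (θ : ℝ) :
    ((I * ξ * circleMap 0 c θ - 1)⁻¹).re + 1 / 2 =
      ((ξ * c) ^ 2 - 1) / (2 * normSq (I * ξ * circleMap 0 c θ - 1)) := by
  have h1 := normSq_pos.2 (I_mul_circleMap_sub_one_ne_zero hc h θ)
  rw [inv_re]
  field_simp
  have h2 : normSq (I * ξ * circleMap 0 c θ) = (ξ * c) ^ 2 := by
    rw [normSq_eq_norm_sq]
    simp [mul_pow]
  rw [normSq_sub, h2]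
  simp
  ring

theorem integral_abs_re_inv_I_mul_circleMap_sub_one_le {c ξ : ℝ} (hc : 0 < c) (hξ : ξ ≠ 0)
    (h : |ξ| * c ≠ 1) :
    ∫ θ in (0 : ℝ)..2 * Real.pi, |((I * ξ * circleMap 0 c θ - 1)⁻¹).re| ≤ 2 * Real.pi := by
  have hk := continuous_I_mul_circleMap_sub_one_inv hc h
  have hre : Continuous fun θ => ((I * ξ * circleMap 0 c θ - 1)⁻¹).re := continuous_re.comp hk
  have hint := integral_exp_div_circleMap 0 hc hξ h
  simp only [zero_mul, exp_zero, one_mul] at hint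
  have hmean : ∫ θ in (0 : ℝ)..2 * Real.pi, ((I * ξ * circleMap 0 c θ - 1)⁻¹).re =
      2 * Real.pi * (-1 + if 1 < |ξ| * c then 1 else 0) := by
    have := reCLM.intervalIntegral_comp_comm (hk.intervalIntegrable (μ := volume) 0 (2 * Real.pi))
    simp only [reCLM_apply] at this
    rw [this, hint]
    split_ifs <;> simp
  have hsq : (ξ * c) ^ 2 = (|ξ| * c) ^ 2 := by rw [mul_pow, mul_pow, sq_abs]
  have hpos : 0 < |ξ| * c := by positivity
  have hpi := Real.two_pi_pos.le
  rcases lt_or_gt_of_ne h with h1 | h1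
  · calc _ ≤ ∫ θ in (0 : ℝ)..2 * Real.pi, -((I * ξ * circleMap 0 c θ - 1)⁻¹).re := by
          refine intervalIntegral.integral_mono hpi (hre.abs.intervalIntegrable _ _)
            (hre.neg.intervalIntegrable _ _) fun θ => ?_
          have h3 := re_inv_I_mul_circleMap_sub_one hc h θ
          have h4 : ((ξ * c) ^ 2 - 1) / (2 * normSq (I * ξ * circleMap 0 c θ - 1)) ≤ 0 :=
            div_nonpos_of_nonpos_of_nonneg (by rw [hsq]; nlinarith)
              (mul_nonneg zero_le_two (normSq_nonneg _))
          exact (abs_of_nonpos (by linarith)).le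
      _ ≤ _ := by
          rw [intervalIntegral.integral_neg, hmean, if_neg h1.not_gt]
          linarith
  · calc _ ≤ ∫ θ in (0 : ℝ)..2 * Real.pi, (((I * ξ * circleMap 0 c θ - 1)⁻¹).re + 1) := by
          refine intervalIntegral.integral_mono hpi (hre.abs.intervalIntegrable _ _)
            ((hre.add continuous_const).intervalIntegrable _ _) fun θ => ?_
          have h3 := re_inv_I_mul_circleMap_sub_one hc h θ
          have h4 : 0 ≤ ((ξ * c) ^ 2 - 1) / (2 * normSq (I * ξ * circleMap 0 c θ - 1)) :=
            div_nonneg (by rw [hsq]; nlinarith) (mul_nonneg zero_le_two (normSq_nonneg _))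
          exact abs_le.2 ⟨by linarith, by linarith⟩
      _ ≤ _ := by
          rw [intervalIntegral.integral_add (hre.intervalIntegrable _ _) intervalIntegrable_const,
            hmean, if_pos h1]
          simp

theorem norm_exp_I_mul_sin (a θ : ℝ) : ‖exp (I * ((a * Real.sin θ : ℝ) : ℂ))‖ = 1 := by
  rw [mul_comm]; exact norm_exp_ofReal_mul_I _

/-- Reflecting `θ ↦ π - θ` replaces the Cauchy kernel by its real part. -/
theorem integral_exp_sin_mul_eq (a : ℝ) {c ξ : ℝ} (hc : 0 < c) (h : |ξ| * c ≠ 1) :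
    ∫ θ in (0 : ℝ)..2 * Real.pi, exp (I * ((a * Real.sin θ : ℝ) : ℂ)) *
      (I * ξ * circleMap 0 c θ - 1)⁻¹ =
    ∫ θ in (0 : ℝ)..2 * Real.pi, exp (I * ((a * Real.sin θ : ℝ) : ℂ)) *
      ((((I * ξ * circleMap 0 c θ - 1)⁻¹).re : ℝ) : ℂ) := by
  set f : ℝ → ℂ := fun θ => exp (I * ((a * Real.sin θ : ℝ) : ℂ)) *
      (I * ξ * circleMap 0 c θ - 1)⁻¹ with hf
  have hcont : Continuous f := by
    have := continuous_I_mul_circleMap_sub_one_inv hc h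
    fun_prop
  have hper : Function.Periodic f (2 * Real.pi) := fun θ => by
    simp only [hf, Real.sin_add_two_pi, periodic_circleMap 0 c θ]
  have hrefl : ∫ θ in (0 : ℝ)..2 * Real.pi, f (Real.pi - θ) =
      ∫ θ in (0 : ℝ)..2 * Real.pi, f θ := by
    rw [intervalIntegral.integral_comp_sub_left, sub_zero]
    have := hper.intervalIntegral_add_eq (Real.pi - 2 * Real.pi) 0
    rwa [zero_add, sub_add_cancel] at this
  have hcont' : Continuous fun θ => f (Real.pi - θ) := by fun_prop
  have hcont' : Continuous fun θ => f (Real.pi - θ) := by fun_prop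
  have hsum : ∫ θ in (0 : ℝ)..2 * Real.pi, (f θ + f (Real.pi - θ)) =
      2 * ∫ θ in (0 : ℝ)..2 * Real.pi, f θ := by
    rw [intervalIntegral.integral_add (hcont.intervalIntegrable _ _)
      (hcont'.intervalIntegrable _ _), hrefl]
    ring
  apply mul_left_cancel₀ (two_ne_zero (α := ℂ))
  rw [← hsum, ← intervalIntegral.integral_const_mul]
  congr 1
  ext θ
  have hconj : (I * ξ * circleMap 0 c (Real.pi - θ) - 1)⁻¹ =
      (starRingEnd ℂ) ((I * ξ * circleMap 0 c θ - 1)⁻¹) := by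
    rw [circleMap_zero_pi_sub]
    simp
  simp only [hf, Real.sin_pi_sub, hconj]
  rw [← mul_add, add_conj]
  push_cast
  ring

theorem norm_integral_exp_sin_mul_le (a : ℝ) {c ξ : ℝ} (hc : 0 < c) (hξ : ξ ≠ 0)
    (h : |ξ| * c ≠ 1) :
    ‖∫ θ in (0 : ℝ)..2 * Real.pi, exp (I * ((a * Real.sin θ : ℝ) : ℂ)) *
      (I * ξ * circleMap 0 c θ - 1)⁻¹‖ ≤ 2 * Real.pi := by
  rw [integral_exp_sin_mul_eq a hc h]
  refine (intervalIntegral.norm_integral_le_integral_norm Real.two_pi_pos.le).trans ?_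
  simpa only [norm_mul, norm_exp_I_mul_sin, one_mul, norm_real, Real.norm_eq_abs] using
    integral_abs_re_inv_I_mul_circleMap_sub_one_le hc hξ h

theorem norm_integral_exp_sin_mul_le_div (a : ℝ) {c ξ : ℝ} (hc : 0 < c) (h : 1 < |ξ| * c) :
    ‖∫ θ in (0 : ℝ)..2 * Real.pi, exp (I * ((a * Real.sin θ : ℝ) : ℂ)) *
      (I * ξ * circleMap 0 c θ - 1)⁻¹‖ ≤ 2 * Real.pi * (|ξ| * c - 1)⁻¹ := by
  have h1 := intervalIntegral.norm_integral_le_of_norm_le_const (a := 0) (b := 2 * Real.pi)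
    (C := (|ξ| * c - 1)⁻¹) (f := fun θ => exp (I * ((a * Real.sin θ : ℝ) : ℂ)) *
      (I * ξ * circleMap 0 c θ - 1)⁻¹) (fun θ _ => by
      rw [norm_mul, norm_exp_I_mul_sin, one_mul, norm_inv]
      refine inv_anti₀ (by linarith) ?_
      have := norm_sub_norm_le (I * ξ * circleMap 0 c θ) 1
      simpa [abs_of_pos hc] using this)
  rwa [sub_zero, abs_of_pos Real.two_pi_pos, mul_comm _ (2 * Real.pi)] at h1

theorem exp_circleMap_eq_exp_sin (s c θ : ℝ) (hc : 0 < c) :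
    exp (s * circleMap 0 c θ - (s * c ^ 2 : ℝ) * (circleMap 0 c θ)⁻¹) =
      exp (I * ((2 * s * c * Real.sin θ : ℝ) : ℂ)) := by
  have hc' : (c : ℂ) ≠ 0 := by exact_mod_cast hc.ne'
  congr 1
  rw [circleMap_zero, mul_inv, ← exp_neg, ← neg_mul, exp_mul_I, exp_mul_I, cos_neg, sin_neg]
  push_cast
  field_simp
  ring

/-- Truncated Fourier transform of `J1fun s` as a Lommel-type integral plus a residue term. -/
theorem integral_J1fun_mul_exp_eq (s : ℝ) {c ξ : ℝ} (hc : 0 < c) (hξ : ξ ≠ 0)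
    (h : |ξ| * c ≠ 1) :
    (∫ t in (0 : ℝ)..s * c ^ 2, ((J1fun s t : ℝ) : ℂ) * exp (I * (t * ξ))) =
      exp (I * ((s * c ^ 2 : ℝ) * ξ)) * ((2 * Real.pi : ℂ)⁻¹ * ∫ θ in (0 : ℝ)..2 * Real.pi,
        exp (I * ((2 * s * c * Real.sin θ : ℝ) : ℂ)) * (I * ξ * circleMap 0 c θ - 1)⁻¹) -
      (-1 + if 1 < |ξ| * c then exp (s * (I * ξ)⁻¹) else 0) := by
  have hcm : Continuous fun θ => circleMap 0 c θ := continuous_circleMap 0 c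
  have hci : Continuous fun θ => (circleMap 0 c θ)⁻¹ :=
    hcm.inv₀ fun θ => circleMap_ne_center hc.ne'
  have hker := continuous_I_mul_circleMap_sub_one_inv hc h
  have hpi : (2 * Real.pi : ℂ) ≠ 0 := by exact_mod_cast Real.two_pi_pos.ne'
  have hswap := intervalIntegral_intervalIntegral_swap (a := 0) (b := s * c ^ 2) (c := 0)
    (d := 2 * Real.pi) (F := fun t θ =>
      exp (s * circleMap 0 c θ - t * (circleMap 0 c θ)⁻¹) * (circleMap 0 c θ)⁻¹ *
        exp (I * (t * ξ))) (by
      have hF : Continuous (Function.uncurry fun (t θ : ℝ) =>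
          exp (s * circleMap 0 c θ - t * (circleMap 0 c θ)⁻¹) * (circleMap 0 c θ)⁻¹ *
          exp (I * (t * ξ))) := by
        have h1 := hcm.comp (continuous_snd (X := ℝ))
        have h2 := hci.comp (continuous_snd (X := ℝ))
        simp only [Function.comp_def] at h1 h2
        simp only [Function.uncurry_def]
        fun_prop
      refine (hF.continuousOn.integrableOn_compact (isCompact_uIcc.prod isCompact_uIcc)).mono_set
        (Set.prod_mono Set.uIoc_subset_uIcc Set.uIoc_subset_uIcc))
  have hinner : ∀ θ : ℝ, (∫ t in (0 : ℝ)..s * c ^ 2,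
      exp (s * circleMap 0 c θ - t * (circleMap 0 c θ)⁻¹) * (circleMap 0 c θ)⁻¹ *
        exp (I * (t * ξ))) =
      exp (I * ((s * c ^ 2 : ℝ) * ξ)) * (exp (I * ((2 * s * c * Real.sin θ : ℝ) : ℂ)) *
        (I * ξ * circleMap 0 c θ - 1)⁻¹) -
        exp (s * circleMap 0 c θ) * (I * ξ * circleMap 0 c θ - 1)⁻¹ := by
    intro θ
    rw [← exp_circleMap_eq_exp_sin s c θ hc]
    have hw : circleMap 0 c θ ≠ 0 := circleMap_ne_center hc.ne'
    have hb := I_mul_circleMap_sub_one_ne_zero hc h θ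
    generalize circleMap 0 c θ = w at hw hb ⊢
    have hd : I * ξ - w⁻¹ = (I * ξ * w - 1) * w⁻¹ := by field_simp
    have hd0 : I * ξ - w⁻¹ ≠ 0 := by rw [hd]; exact mul_ne_zero hb (inv_ne_zero hw)
    have e : ∀ t : ℝ, exp (s * w - t * w⁻¹) * w⁻¹ * exp (I * (t * ξ)) =
        exp (s * w) * w⁻¹ * exp ((I * ξ - w⁻¹) * t) := by
      intro t
      rw [mul_right_comm, ← exp_add, mul_right_comm (exp (s * w)), ← exp_add]
      ring_nf
    simp only [e]
    rw [intervalIntegral.integral_const_mul, integral_exp_mul_complex hd0, hd]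
    have e2 : exp (I * ((s * c ^ 2 : ℝ) * ξ)) * exp (s * w - (s * c ^ 2 : ℝ) * w⁻¹) =
        exp (s * w) * exp ((I * ξ * w - 1) * w⁻¹ * (s * c ^ 2 : ℝ)) := by
      rw [← hd, ← exp_add, ← exp_add]
      ring_nf
    rw [← mul_assoc, e2, ofReal_zero, mul_zero, exp_zero, div_eq_mul_inv, mul_inv, inv_inv]
    field_simp
  simp only [J1fun_eq_integral s _ hc, mul_assoc (2 * Real.pi : ℂ)⁻¹,
    intervalIntegral.integral_const_mul, ← intervalIntegral.integral_mul_const]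
  rw [hswap]
  simp only [hinner]
  rw [intervalIntegral.integral_sub (Continuous.intervalIntegrable (by fun_prop) _ _)
    (Continuous.intervalIntegrable (by fun_prop) _ _), intervalIntegral.integral_const_mul,
    integral_exp_div_circleMap _ hc hξ h, mul_sub, inv_mul_cancel_left₀ hpi]
  ring

theorem continuous_J1fun_right (s : ℝ) : Continuous (J1fun s) := by
  have hcm : Continuous fun θ => circleMap 0 1 θ := continuous_circleMap 0 1
  have hci : Continuous fun θ => (circleMap 0 1 θ)⁻¹ :=
    hcm.inv₀ fun θ => circleMap_ne_center one_ne_zero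
  have h : Continuous fun t : ℝ => ((J1fun s t : ℝ) : ℂ) := by
    simp only [J1fun_eq_integral s _ one_pos]
    refine continuous_const.mul
      (intervalIntegral.continuous_parametric_intervalIntegral_of_continuous' ?_ _ _)
    have h1 := hcm.comp (continuous_snd (X := ℝ))
    have h2 := hci.comp (continuous_snd (X := ℝ))
    simp only [Function.comp_def] at h1 h2
    simp only [Function.uncurry_def]
    fun_prop
  simpa only [Function.comp_def, ofReal_re] using continuous_re.comp h

theorem norm_exp_mul_inv_I_mul (s ξ : ℝ) : ‖exp (s * (I * ξ)⁻¹)‖ = 1 := by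
  rw [mul_inv, inv_I, show (s : ℂ) * (-I * (ξ : ℂ)⁻¹) = ((-s * ξ⁻¹ : ℝ) : ℂ) * I by push_cast; ring]
  exact norm_exp_ofReal_mul_I _

/-- The truncated Fourier transforms of `J1fun s` are uniformly bounded. -/
theorem norm_integral_J1fun_mul_exp_le (s : ℝ) {c ξ : ℝ} (hc : 0 < c) (hξ : ξ ≠ 0)
    (h : |ξ| * c ≠ 1) :
    ‖∫ t in (0 : ℝ)..s * c ^ 2, ((J1fun s t : ℝ) : ℂ) * exp (I * (t * ξ))‖ ≤ 3 := by
  have hpi : 0 < 2 * Real.pi := Real.two_pi_pos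
  have hn : ‖(2 * Real.pi : ℂ)⁻¹‖ = (2 * Real.pi)⁻¹ := by
    simp [abs_of_pos Real.pi_pos]
  have h1 : ‖exp (I * ((s * c ^ 2 : ℝ) * ξ))‖ = 1 := by
    rw [mul_comm, ← ofReal_mul]; exact norm_exp_ofReal_mul_I _
  have h2 : ‖(-1 + if 1 < |ξ| * c then exp (s * (I * ξ)⁻¹) else 0 : ℂ)‖ ≤ 2 := by
    refine (norm_add_le _ _).trans ?_
    rw [norm_neg, norm_one]
    split_ifs
    · rw [norm_exp_mul_inv_I_mul]; norm_num
    · norm_num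
  rw [integral_J1fun_mul_exp_eq s hc hξ h]
  refine (norm_sub_le _ _).trans ?_
  rw [norm_mul, norm_mul, h1, hn, one_mul]
  have h3 := norm_integral_exp_sin_mul_le (2 * s * c) hc hξ h
  have h4 := mul_le_mul_of_nonneg_left h3 (inv_nonneg.2 hpi.le)
  rw [inv_mul_cancel₀ hpi.ne'] at h4
  linarith

theorem tendsto_integral_J1fun_mul_exp {s ξ : ℝ} (hs : 0 < s) (hξ : ξ ≠ 0) :
    Tendsto (fun R : ℝ => ∫ t in (0 : ℝ)..R, ((J1fun s t : ℝ) : ℂ) * exp (I * (t * ξ)))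
      atTop (nhds (1 - exp (s * (I * ξ)⁻¹))) := by
  have hξ' : 0 < |ξ| := abs_pos.2 hξ
  have hpi : 0 < 2 * Real.pi := Real.two_pi_pos
  have hn : ‖(2 * Real.pi : ℂ)⁻¹‖ = (2 * Real.pi)⁻¹ := by
    simp [abs_of_pos Real.pi_pos]
  have hc : Tendsto (fun R : ℝ => |ξ| * √(R / s) - 1) atTop atTop := by
    refine tendsto_atTop_add_const_right _ _ (Tendsto.const_mul_atTop hξ' ?_)
    exact Real.tendsto_sqrt_atTop.comp (tendsto_id.atTop_div_const hs)
  rw [tendsto_iff_norm_sub_tendsto_zero]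
  refine squeeze_zero' (Eventually.of_forall fun _ => norm_nonneg _) ?_
    (tendsto_inv_atTop_zero.comp hc)
  filter_upwards [eventually_gt_atTop 0, hc.eventually_gt_atTop 0] with R hR hR1
  have hc0 : 0 < √(R / s) := Real.sqrt_pos.2 (div_pos hR hs)
  have hRs : s * √(R / s) ^ 2 = R := by
    rw [Real.sq_sqrt (div_pos hR hs).le]; field_simp
  have hR2 : 1 < |ξ| * √(R / s) := by linarith
  have h1 : ‖exp (I * ((s * √(R / s) ^ 2 : ℝ) * ξ))‖ = 1 := by
    rw [mul_comm, ← ofReal_mul]; exact norm_exp_ofReal_mul_I _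
  have e := integral_J1fun_mul_exp_eq s hc0 hξ hR2.ne'
  have hb := norm_integral_exp_sin_mul_le_div (2 * s * √(R / s)) hc0 hR2
  rw [if_pos hR2] at e
  have e' := congrArg (fun z => ‖z - (1 - exp (s * (I * ξ)⁻¹))‖) e
  simp only [sub_sub, show ∀ z : ℂ, -1 + z + (1 - z) = 0 from
    fun z => by ring, sub_zero, norm_mul, h1, hn, one_mul] at e'
  rw [hRs] at e'
  simp only [Function.comp_apply]
  rw [e']
  have h4 := mul_le_mul_of_nonneg_left hb (inv_nonneg.2 hpi.le)
  rwa [inv_mul_cancel_left₀ hpi.ne'] at h4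

theorem integrable_J1fun_mul_exp_mul (φ : ℝ → ℂ) (hφ : Integrable φ) (s R : ℝ) :
    Integrable (Function.uncurry fun t ξ : ℝ => ((J1fun s t : ℝ) : ℂ) * exp (I * (t * ξ)) * φ ξ)
      ((volume.restrict (Set.uIoc 0 R)).prod volume) := by
  have hJ : Integrable (fun t : ℝ => ((J1fun s t : ℝ) : ℂ)) (volume.restrict (Set.uIoc 0 R)) :=
    intervalIntegrable_iff.1
      ((continuous_ofReal.comp (continuous_J1fun_right s)).intervalIntegrable 0 R)
  refine ((hJ.mul_prod hφ).bdd_mul (f := fun z : ℝ × ℝ => exp (I * (z.1 * z.2))) (c := 1)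
    (Continuous.aestronglyMeasurable (by fun_prop)) (ae_of_all _ fun z => ?_)).congr
    (ae_of_all _ fun z => ?_)
  · rw [mul_comm, ← ofReal_mul]; exact (norm_exp_ofReal_mul_I _).le
  · simp only [Function.uncurry_def]; ring

theorem integral_J1fun_mul_KGsol (φ : ℝ → ℂ) (hφ : Integrable φ) (s R : ℝ) :
    (∫ t in (0 : ℝ)..R, ((J1fun s t : ℝ) : ℂ) * KGsol φ t 0) =
      ∫ ξ : ℝ, (∫ t in (0 : ℝ)..R, ((J1fun s t : ℝ) : ℂ) * exp (I * (t * ξ))) * φ ξ := by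
  have h := intervalIntegral_integral_swap (integrable_J1fun_mul_exp_mul φ hφ s R)
  simpa only [KGsol, ofReal_zero, zero_div, add_zero, mul_assoc, integral_const_mul,
    intervalIntegral.integral_mul_const, ← integral_const_mul,
    ← intervalIntegral.integral_mul_const] using h

theorem aestronglyMeasurable_integral_J1fun_mul_exp (φ : ℝ → ℂ) (hφ : Integrable φ) {s R : ℝ}
    (hR : 0 ≤ R) :
    AEStronglyMeasurable (fun ξ : ℝ =>
      (∫ t in (0 : ℝ)..R, ((J1fun s t : ℝ) : ℂ) * exp (I * (t * ξ))) * φ ξ) := by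
  have h := (integrable_J1fun_mul_exp_mul φ hφ s R).integral_prod_right.aestronglyMeasurable
  simp only [Set.uIoc_of_le hR] at h
  simpa only [Function.uncurry_apply_pair, integral_mul_const,
    intervalIntegral.integral_of_le hR] using h

theorem integrable_KGsol_integrand (φ : ℝ → ℂ) (hφ : Integrable φ) (x y : ℝ) :
    Integrable fun t : ℝ => exp (I * ((x : ℂ) * (t : ℂ) + (y : ℂ) / (t : ℂ))) * φ t := by
  refine hφ.bdd_mul (c := 1) (Measurable.aestronglyMeasurable (by fun_prop))
    (ae_of_all _ fun t => ?_)
  rw [mul_comm, ← ofReal_mul, ← ofReal_div, ← ofReal_add]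
  exact (norm_exp_ofReal_mul_I _).le

/-- For `φ ∈ L¹(ℝ)` and `u = KGsol φ`, for every `y ≤ 0` the improper
integral `∫₀^∞ J₁(−y, t) u(t, 0) dt = lim_{R→∞} ∫₀^R J₁(−y, t) u(t, 0) dt` exists
and `u(0, y) = u(0, 0) − ∫₀^∞ J₁(−y, t) u(t, 0) dt`. -/
theorem statement18 (φ : ℝ → ℂ) (hφ : Integrable φ) :
    ∀ y : ℝ, y ≤ 0 → ∃ L : ℂ,
      Tendsto (fun R : ℝ => ∫ t in (0 : ℝ)..R, ((J1fun (-y) t : ℝ) : ℂ) * KGsol φ t 0)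
        atTop (nhds L) ∧
      KGsol φ 0 y = KGsol φ 0 0 - L := by
  intro y hy
  refine ⟨KGsol φ 0 0 - KGsol φ 0 y, ?_, by ring⟩
  rcases hy.eq_or_lt with rfl | hy
  · simp [J1fun]
  have hs : 0 < -y := neg_pos.2 hy
  have hL : KGsol φ 0 0 - KGsol φ 0 y =
      ∫ ξ : ℝ, (1 - exp ((-y : ℝ) * (I * ξ)⁻¹)) * φ ξ := by
    rw [KGsol, KGsol, ← integral_sub (integrable_KGsol_integrand φ hφ 0 0)
      (integrable_KGsol_integrand φ hφ 0 y)]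
    congr 1
    ext ξ
    rw [← sub_mul, mul_inv, inv_I]
    simp only [ofReal_zero, zero_mul, zero_div, add_zero, mul_zero, exp_zero, zero_add]
    push_cast
    ring_nf
  simp only [integral_J1fun_mul_KGsol φ hφ]
  rw [hL]
  refine tendsto_integral_filter_of_dominated_convergence (fun ξ => 3 * ‖φ ξ‖) ?_ ?_
    (hφ.norm.const_mul 3) ?_
  · filter_upwards [eventually_ge_atTop 0] with R hR
    exact aestronglyMeasurable_integral_J1fun_mul_exp φ hφ hR
  · filter_upwards [eventually_gt_atTop 0] with R hR
    have hc0 : 0 < √(R / -y) := Real.sqrt_pos.2 (div_pos hR hs)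
    have hRs : -y * √(R / -y) ^ 2 = R := by
      rw [Real.sq_sqrt (div_pos hR hs).le, ← mul_div_assoc, mul_div_cancel_left₀ _ hs.ne']
    have hfin : ({0, (√(R / -y))⁻¹, -(√(R / -y))⁻¹} : Set ℝ).Countable :=
      (Set.toFinite _).countable
    filter_upwards [hfin.ae_notMem volume] with ξ hξ
    simp only [Set.mem_insert_iff, Set.mem_singleton_iff, not_or] at hξ
    have hb := norm_integral_J1fun_mul_exp_le (-y) hc0 hξ.1 (by
      intro h
      rcases abs_eq (inv_nonneg.2 hc0.le) |>.1 (eq_inv_of_mul_eq_one_left h) with h | h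
      exacts [hξ.2.1 h, hξ.2.2 h])
    rw [hRs] at hb
    rw [norm_mul]
    gcongr
  · filter_upwards [(Set.countable_singleton (0 : ℝ)).ae_notMem volume] with ξ hξ
    exact (tendsto_integral_J1fun_mul_exp hs hξ).mul_const _

end
end
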